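/- arXiv:2504.10209 — 4 statements merged into one kernel-verified Lean document; each statement's English description precedes it below -/
import Mathlib

section
/- Let K be a nonarchimedean field, let M, N, P be Banach K-vector spaces, let φ : M → N be a K-linear map, and let a : N → P be a continuous K-linear map. Then the composition a ∘ φ : M → P is continuous if and only if a(𝔖(φ)) = 0, where 𝔖(φ) is the separating space of φ. -/
/-- The separating space of a map `φ : M → N`: the set of `y ∈ N` which are limits
of `φ (x n)` for some sequence `x n → 0` in `M`. -/
def separatingSpace {M N : Type*} [TopologicalSpace M] [TopologicalSpace N] [Zero M]
    (φ : M → N) : Set N :=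
  {y | ∃ x : ℕ → M, Filter.Tendsto x Filter.atTop (nhds (0 : M)) ∧
        Filter.Tendsto (fun n => φ (x n)) Filter.atTop (nhds y)}

/-- A point `(m, y)` in the closure of the graph of `φ` satisfies `y - φ m ∈ 𝔖(φ)`. -/
theorem sub_mem_separatingSpace_of_mem_closure_graph
    {K M N : Type*} [NontriviallyNormedField K]
    [NormedAddCommGroup M] [NormedSpace K M] [NormedAddCommGroup N] [NormedSpace K N]
    (φ : M →ₗ[K] N) {p : M × N} (hp : p ∈ φ.graph.topologicalClosure) :
    p.2 - φ p.1 ∈ separatingSpace (fun m => φ m) := by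
  rw [← SetLike.mem_coe, Submodule.topologicalClosure_coe, mem_closure_iff_seq_limit] at hp
  obtain ⟨u, hu, hlim⟩ := hp
  refine ⟨fun n => (u n).1 - p.1, ?_, ?_⟩
  · simpa using ((continuous_fst.tendsto p).comp hlim).sub_const p.1
  · have h_graph : ∀ n, φ ((u n).1 - p.1) = (u n).2 - φ p.1 := fun n => by
      rw [map_sub, (φ.mem_graph_iff _).mp (hu n)]
    simpa only [h_graph, Function.comp_def] using ((continuous_snd.tendsto p).comp hlim).sub_const (φ p.1)

/-- Lemma 6.2 (2): for a `K`-linear map `φ : M → N` and a continuous `K`-linear map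
`a : N → P` between Banach `K`-spaces, the composite `a ∘ φ` is continuous iff `a`
annihilates the separating space of `φ`. -/
theorem comp_continuous_iff_separatingSpace_maps_to_zero
    {K M N P : Type*} [NontriviallyNormedField K] [CompleteSpace K] [IsUltrametricDist K]
    [NormedAddCommGroup M] [NormedSpace K M] [CompleteSpace M]
    [NormedAddCommGroup N] [NormedSpace K N] [CompleteSpace N]
    [NormedAddCommGroup P] [NormedSpace K P] [CompleteSpace P]
    (φ : M →ₗ[K] N) (a : N →L[K] P) :
    Continuous (fun m => a (φ m)) ↔
      ∀ y ∈ separatingSpace (fun m => φ m), a y = 0 := by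
  constructor
  · rintro h y ⟨x, hx, hy⟩
    have h₁ : Filter.Tendsto (fun n => a (φ (x n))) Filter.atTop (nhds (a y)) :=
      (a.continuous.tendsto y).comp hy
    have h₂ : Filter.Tendsto (fun n => a (φ (x n))) Filter.atTop (nhds 0) := by
      simpa [Function.comp_def] using (h.tendsto 0).comp hx
    exact tendsto_nhds_unique h₁ h₂
  · intro h
    let G : Submodule K (M × N) := φ.graph.topologicalClosure
    have : CompleteSpace G := φ.graph.isClosed_topologicalClosure.completeSpace_coe
    let π : G →L[K] M := (ContinuousLinearMap.fst K M N).comp G.subtypeL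
    have hπ : Function.Surjective π := fun m =>
      ⟨⟨(m, φ m), φ.graph.le_topologicalClosure rfl⟩, rfl⟩
    rw [(π.isQuotientMap hπ).continuous_iff]
    have h_eq : (fun m => a (φ m)) ∘ π = fun g : G => a (g : M × N).2 := by
      funext g
      have hg := h _ (sub_mem_separatingSpace_of_mem_closure_graph φ g.2)
      rw [map_sub, sub_eq_zero] at hg
      exact hg.symm
    rw [h_eq]
    fun_prop
end

section
/- Let K be a nonarchimedean field and let φ : M → N be a K-linear map between two Banach K-vector spaces. Assume that there exist sequences (R_n)_{n≥1} and (L_n)_{n≥1} of continuous K-linear endomorphisms of M and of N respectively, such that φ ∘ R_n − L_n ∘ φ : M → N is continuous for every n. Then there exists a positive integer k such that for all n ≥ k the topological closures satisfy cl(L_1 L_2 ⋯ L_n 𝔖(φ)) = cl(L_1 L_2 ⋯ L_k 𝔖(φ)). -/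
/-- The composition `L 1 ∘ L 2 ∘ ⋯ ∘ L n` of the first `n` terms of a sequence of
continuous linear endomorphisms. -/
noncomputable def composeFirst {K N : Type*} [NontriviallyNormedField K]
    [NormedAddCommGroup N] [NormedSpace K N] (L : ℕ → N →L[K] N) : ℕ → N →L[K] N
  | 0 => ContinuousLinearMap.id K N
  | n + 1 => (composeFirst L n).comp (L (n + 1))

open Filter Topology

section ComposeFirst

variable {K M N : Type*} [NontriviallyNormedField K]
  [NormedAddCommGroup M] [NormedSpace K M] [NormedAddCommGroup N] [NormedSpace K N]

theorem composeFirst_add (L : ℕ → N →L[K] N) (i d : ℕ) :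
    composeFirst L (i + d) =
      (composeFirst L i).comp (composeFirst (fun n => L (i + n)) d) := by
  induction d with
  | zero => rfl
  | succ d ih =>
    change (composeFirst L (i + d)).comp (L (i + d + 1)) = _
    rw [ih]
    rfl

theorem continuous_composeFirst_sub (φ : M →ₗ[K] N) (R : ℕ → M →L[K] M) (L : ℕ → N →L[K] N)
    (hcont : ∀ n : ℕ, 1 ≤ n → Continuous fun m => φ (R n m) - L n (φ m)) (n : ℕ) :
    Continuous fun m => φ (composeFirst R n m) - composeFirst L n (φ m) := by
  induction n with
  | zero => simpa [composeFirst] using continuous_const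
  | succ n ih =>
    have h := (ih.comp (R (n + 1)).continuous).add
      ((composeFirst L n).continuous.comp (hcont (n + 1) (by omega)))
    refine h.congr fun m => ?_
    simp [composeFirst]

end ComposeFirst

section SeparatingSpace

variable {K M N P : Type*} [NontriviallyNormedField K]
  [NormedAddCommGroup M] [NormedSpace K M] [NormedAddCommGroup N] [NormedSpace K N]
  [SeminormedAddCommGroup P] [NormedSpace K P]

/-- The separating space of a linear map, as a submodule. -/
def separatingSubmodule (φ : M →ₗ[K] N) : Submodule K N where
  carrier := separatingSpace (fun m => φ m)
  zero_mem' := ⟨fun _ => 0, tendsto_const_nhds, by simp⟩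
  add_mem' := by
    rintro a b ⟨x, hx, hx'⟩ ⟨y, hy, hy'⟩
    exact ⟨fun n => x n + y n, by simpa using hx.add hy, by simpa using hx'.add hy'⟩
  smul_mem' := by
    rintro c a ⟨x, hx, hx'⟩
    exact ⟨fun n => c • x n, by simpa using hx.const_smul c, by simpa using hx'.const_smul c⟩

theorem mem_separatingSpace_iff (φ : M →ₗ[K] N) (y : N) :
    y ∈ separatingSpace (fun m => φ m) ↔
      ∀ ε > 0, ∃ x : M, ‖x‖ < ε ∧ ‖φ x - y‖ < ε := by
  constructor
  · rintro ⟨x, hx, hx'⟩ ε hε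
    have h1 := (Metric.tendsto_nhds.1 hx) ε hε
    have h2 := (Metric.tendsto_nhds.1 hx') ε hε
    obtain ⟨n, h1, h2⟩ := (h1.and h2).exists
    exact ⟨x n, by simpa using h1, by simpa [dist_eq_norm] using h2⟩
  · intro h
    have hpos (n : ℕ) : (0 : ℝ) < 1 / ((n : ℝ) + 1) := by positivity
    choose x hx hx' using fun n : ℕ => h (1 / ((n : ℝ) + 1)) (hpos n)
    refine ⟨x, squeeze_zero_norm (fun n => (hx n).le) tendsto_one_div_add_atTop_nhds_zero_nat,
      ?_⟩
    rw [tendsto_iff_norm_sub_tendsto_zero]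
    exact squeeze_zero (fun n => norm_nonneg _) (fun n => (hx' n).le)
      tendsto_one_div_add_atTop_nhds_zero_nat

theorem isClosed_separatingSpace (φ : M →ₗ[K] N) :
    IsClosed (separatingSpace fun m => φ m) := by
  refine isClosed_of_closure_subset fun y hy => ?_
  rw [mem_separatingSpace_iff]
  intro ε hε
  obtain ⟨z, hz, hyz⟩ := Metric.mem_closure_iff.1 hy (ε / 2) (half_pos hε)
  obtain ⟨x, hx, hx'⟩ := (mem_separatingSpace_iff φ z).1 hz (ε / 2) (half_pos hε)
  refine ⟨x, by linarith, ?_⟩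
  calc ‖φ x - y‖ ≤ ‖φ x - z‖ + ‖z - y‖ := norm_sub_le_norm_sub_add_norm_sub _ _ _
    _ < ε := by rw [dist_comm, dist_eq_norm] at hyz; linarith

theorem continuous_mkQ_separatingSubmodule [CompleteSpace K] [CompleteSpace M] [CompleteSpace N]
    (φ : M →ₗ[K] N) : Continuous ((separatingSubmodule φ).mkQ ∘ₗ φ) := by
  have : IsClosed (separatingSubmodule φ : Set N) := isClosed_separatingSpace φ
  refine LinearMap.continuous_of_seq_closed_graph (g := (separatingSubmodule φ).mkQ ∘ₗ φ) ?_
  intro u x y hu hy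
  obtain ⟨y, rfl⟩ := Submodule.mkQ_surjective _ y
  rw [eq_comm, ← sub_eq_zero, LinearMap.comp_apply, ← map_sub, Submodule.mkQ_apply,
    Submodule.Quotient.mk_eq_zero]
  change _ ∈ separatingSpace _
  rw [mem_separatingSpace_iff]
  intro ε hε
  have h1 := (Metric.tendsto_nhds.1 hu) (ε / 2) (half_pos hε)
  have h2 := (Metric.tendsto_nhds.1 hy) (ε / 2) (half_pos hε)
  obtain ⟨n, h1, h2⟩ := (h1.and h2).exists
  rw [dist_eq_norm] at h1 h2
  rw [Function.comp_apply, LinearMap.comp_apply, ← map_sub, Submodule.mkQ_apply] at h2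
  obtain ⟨z, hz, hz'⟩ := Submodule.Quotient.norm_mk_lt
    ((separatingSubmodule φ).mkQ (φ (u n) - y)) (sub_pos.2 h2)
  have hmem : φ (u n) - y - z ∈ separatingSubmodule φ := (Submodule.Quotient.eq _).1 hz.symm
  obtain ⟨v, hv, hv'⟩ := (mem_separatingSpace_iff φ _).1 hmem (ε / 2) (half_pos hε)
  have hz'' : ‖z‖ < ε / 2 := by simpa using hz'
  refine ⟨v - (u n - x), ?_, ?_⟩
  · linarith [norm_sub_le v (u n - x)]
  · have h : φ (v - (u n - x)) - (φ x - y) = (φ v - (φ (u n) - y - z)) - z := by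
      simp only [map_sub]
      abel
    rw [h]
    linarith [norm_sub_le (φ v - (φ (u n) - y - z)) z]

theorem continuous_comp_of_forall_separatingSpace [CompleteSpace K] [CompleteSpace M]
    [CompleteSpace N] (φ : M →ₗ[K] N) (T : N →L[K] P)
    (hT : ∀ y ∈ separatingSpace (fun m => φ m), T y = 0) :
    Continuous fun m => T (φ m) := by
  have h : Continuous ((separatingSubmodule φ).liftQ (T : N →ₗ[K] P) hT) :=
    continuous_quot_lift _ T.continuous
  exact h.comp (continuous_mkQ_separatingSubmodule φ)

end SeparatingSpace


section GlidingHump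

variable {K M : Type*} [NontriviallyNormedField K] [NormedAddCommGroup M] [NormedSpace K M]

theorem exists_le_norm_of_not_continuous {F : Type*} [SeminormedAddCommGroup F] [NormedSpace K F]
    (f : M →ₗ[K] F) (hf : ¬ Continuous f) {U : Set M} (hU : U ∈ 𝓝 (0 : M)) (C : ℝ) :
    ∃ x ∈ U, C ≤ ‖f x‖ := by
  by_contra! h
  refine hf (f.clmOfExistsBoundedImage ⟨U, hU, ?_⟩).continuous
  rw [NormedSpace.isVonNBounded_iff, isBounded_iff_forall_norm_le]
  refine ⟨C, ?_⟩
  rintro _ ⟨x, hx, rfl⟩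
  exact (h x hx).le

theorem eventually_continuous_comp_composeFirst [CompleteSpace M] {F : ℕ → Type*}
    [∀ n, SeminormedAddCommGroup (F n)] [∀ n, NormedSpace K (F n)]
    (R : ℕ → M →L[K] M) (ψ : ∀ n, M →ₗ[K] F n)
    (hbdd : ∀ x, ∃ C, ∀ n, ‖ψ n x‖ ≤ C)
    (hcont : ∀ n, Continuous fun x => ψ n (composeFirst R n x)) :
    ∀ᶠ n in atTop, Continuous fun x => ψ (n + 1) (composeFirst R n x) := by
  by_contra hbad
  rw [not_eventually] at hbad
  have hC (n : ℕ) : ∃ C, 0 < C ∧ ∀ x, ‖ψ n (composeFirst R n x)‖ ≤ C * ‖x‖ :=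
    (⟨ψ n ∘ₗ (composeFirst R n : M →ₗ[K] M), hcont n⟩ : M →L[K] F n).bound
  choose C hCpos hC using hC
  have hstep (n : ℕ) (s : M) : ∃ x : M,
      (∀ i ∈ Finset.range (n + 1),
        ‖composeFirst (fun k => R (i + k)) (n - i) x‖ < (1 / 2) ^ n / max 1 (C i)) ∧
      (¬ (Continuous fun x => ψ (n + 1) (composeFirst R n x)) →
        n + ‖ψ (n + 1) s‖ ≤ ‖ψ (n + 1) (composeFirst R n x)‖) := by
    have hU : {x : M | ∀ i ∈ Finset.range (n + 1),
        ‖composeFirst (fun k => R (i + k)) (n - i) x‖ < (1 / 2) ^ n / max 1 (C i)}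
        ∈ 𝓝 (0 : M) := by
      refine (Finset.eventually_all _).2 fun i _ => ?_
      refine (composeFirst (fun k => R (i + k)) (n - i)).continuous.norm.continuousAt.eventually_lt
        continuousAt_const ?_
      simp only [map_zero, norm_zero]
      positivity
    by_cases h : Continuous fun x => ψ (n + 1) (composeFirst R n x)
    · exact ⟨0, mem_of_mem_nhds hU, fun h' => (h' h).elim⟩
    · obtain ⟨x, hx, hx'⟩ := exists_le_norm_of_not_continuous
        (ψ (n + 1) ∘ₗ (composeFirst R n : M →ₗ[K] M)) h hU (n + ‖ψ (n + 1) s‖)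
      exact ⟨x, hx, fun _ => hx'⟩
  choose f hf hf' using hstep
  let s : ℕ → M := fun n => Nat.rec 0 (fun n t => t + composeFirst R n (f n t)) n
  let x : ℕ → M := fun n => f n (s n)
  have hs (n : ℕ) : s n = ∑ j ∈ Finset.range n, composeFirst R j (x j) := by
    induction n with
    | zero => rfl
    | succ n ih => rw [Finset.sum_range_succ, ← ih]
  have hx (i d : ℕ) : ‖composeFirst (fun k => R (i + k)) d (x (i + d))‖ ≤
      (1 / 2) ^ d / max 1 (C i) := by
    have h := (hf (i + d) (s (i + d)) i (by simp)).le
    rw [Nat.add_sub_cancel_left] at h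
    refine h.trans ?_
    gcongr ?_ / _
    exact pow_le_pow_of_le_one (by norm_num) (by norm_num) (by omega)
  have hsum (i : ℕ) : Summable fun d => composeFirst (fun k => R (i + k)) d (x (i + d)) :=
    Summable.of_norm_bounded (summable_geometric_two.div_const _) (hx i)
  have hnorm (i : ℕ) : ‖∑' d, composeFirst (fun k => R (i + k)) d (x (i + d))‖ ≤
      2 / max 1 (C i) :=
    tsum_of_norm_bounded (hasSum_geometric_two.div_const _) (hx i)
  have hsum0 : Summable fun j => composeFirst R j (x j) := by simpa using hsum 0
  obtain ⟨B, hB⟩ := hbdd (∑' j, composeFirst R j (x j))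
  obtain ⟨n, hn, hnB⟩ := (hbad.and_eventually
    (tendsto_natCast_atTop_atTop.eventually_gt_atTop (B + 2))).exists
  set t := ∑' d, composeFirst (fun k => R (n + 1 + k)) d (x (n + 1 + d))
  have hsplit : ∑' j, composeFirst R j (x j) =
      s n + composeFirst R n (x n) + composeFirst R (n + 1) t := by
    rw [← hsum0.sum_add_tsum_nat_add (n + 1), Finset.sum_range_succ, ← hs,
      ContinuousLinearMap.map_tsum _ (hsum (n + 1))]
    congr 1
    refine tsum_congr fun d => ?_
    rw [add_comm d, composeFirst_add R (n + 1) d]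
    rfl
  have h1 : ‖ψ (n + 1) (composeFirst R (n + 1) t)‖ ≤ 2 := by
    refine (hC (n + 1) t).trans ?_
    have hmax : 0 < max 1 (C (n + 1)) := by positivity
    calc C (n + 1) * ‖t‖ ≤ max 1 (C (n + 1)) * (2 / max 1 (C (n + 1))) := by
          gcongr
          · exact le_max_right _ _
          · exact hnorm (n + 1)
      _ = 2 := by field_simp
  have h2 := hf' n (s n) hn
  have h3 := hB (n + 1)
  rw [hsplit, map_add, map_add] at h3
  have h4 : ψ (n + 1) (composeFirst R n (x n)) =
      (ψ (n + 1) (s n) + ψ (n + 1) (composeFirst R n (x n)) +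
        ψ (n + 1) (composeFirst R (n + 1) t)) -
      ψ (n + 1) (s n) - ψ (n + 1) (composeFirst R (n + 1) t) := by abel
  have h5 := congrArg norm h4
  have h6 := norm_sub_le ((ψ (n + 1) (s n) + ψ (n + 1) (composeFirst R n (x n)) +
        ψ (n + 1) (composeFirst R (n + 1) t)) -
      ψ (n + 1) (s n)) (ψ (n + 1) (composeFirst R (n + 1) t))
  have h7 := norm_sub_le (ψ (n + 1) (s n) + ψ (n + 1) (composeFirst R n (x n)) +
        ψ (n + 1) (composeFirst R (n + 1) t)) (ψ (n + 1) (s n))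
  change (n : ℝ) + ‖ψ (n + 1) (s n)‖ ≤ ‖ψ (n + 1) (composeFirst R n (x n))‖ at h2
  linarith

end GlidingHump

section Stabilization

variable {K M N : Type*} [NontriviallyNormedField K]
  [NormedAddCommGroup M] [NormedSpace K M] [NormedAddCommGroup N] [NormedSpace K N]

theorem map_mem_separatingSpace (φ : M →ₗ[K] N) (R : M →L[K] M) (L : N →L[K] N)
    (hcont : Continuous fun m => φ (R m) - L (φ m)) {y : N}
    (hy : y ∈ separatingSpace fun m => φ m) : L y ∈ separatingSpace fun m => φ m := by
  obtain ⟨x, hx, hx'⟩ := hy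
  refine ⟨fun n => R (x n), by simpa [Function.comp_def] using (R.continuous.tendsto 0).comp hx, ?_⟩
  have h1 := (hcont.tendsto 0).comp hx
  have h2 := (L.continuous.tendsto y).comp hx'
  simpa [Function.comp_def] using h1.add h2

theorem eq_zero_of_mem_separatingSpace {P : Type*} [NormedAddCommGroup P] [NormedSpace K P]
    (φ : M →ₗ[K] N) (T : N →L[K] P) (hT : Continuous fun m => T (φ m)) {y : N}
    (hy : y ∈ separatingSpace fun m => φ m) : T y = 0 := by
  obtain ⟨x, hx, hx'⟩ := hy
  have h1 := (hT.tendsto 0).comp hx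
  have h2 := (T.continuous.tendsto y).comp hx'
  simpa using tendsto_nhds_unique h2 h1

theorem antitone_closure_image_composeFirst (φ : M →ₗ[K] N) (R : ℕ → M →L[K] M)
    (L : ℕ → N →L[K] N)
    (hcont : ∀ n : ℕ, 1 ≤ n → Continuous fun m => φ (R n m) - L n (φ m)) :
    Antitone fun n => closure (composeFirst L n '' separatingSpace (fun m => φ m)) := by
  refine antitone_nat_of_succ_le fun n => closure_mono ?_
  rintro _ ⟨y, hy, rfl⟩
  exact ⟨L (n + 1) y, map_mem_separatingSpace φ _ _ (hcont (n + 1) (by omega)) hy, rfl⟩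

/-- The closure of `L 1 ⋯ L n 𝔖(φ)`, as a submodule. -/
noncomputable def stableSubmodule (φ : M →ₗ[K] N) (L : ℕ → N →L[K] N) (n : ℕ) : Submodule K N :=
  ((separatingSubmodule φ).map (composeFirst L n : N →ₗ[K] N)).topologicalClosure

instance isClosed_stableSubmodule (φ : M →ₗ[K] N) (L : ℕ → N →L[K] N) (n : ℕ) :
    IsClosed (stableSubmodule φ L n : Set N) := isClosed_closure

/-- The quotient map `N → N ⧸ S` as a continuous linear map. -/
def quotientCLM (S : Submodule K N) : N →L[K] N ⧸ S := ⟨S.mkQ, continuous_quot_mk⟩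

theorem quotientCLM_eq_zero_iff (S : Submodule K N) (y : N) : quotientCLM S y = 0 ↔ y ∈ S :=
  Submodule.Quotient.mk_eq_zero S

theorem continuous_quotientCLM_comp_iff (φ : M →ₗ[K] N) (R : ℕ → M →L[K] M) (L : ℕ → N →L[K] N)
    (hcont : ∀ n : ℕ, 1 ≤ n → Continuous fun m => φ (R n m) - L n (φ m))
    (S : Submodule K N) (n : ℕ) :
    (Continuous fun m => quotientCLM S (φ (composeFirst R n m))) ↔
      Continuous fun m => quotientCLM S (composeFirst L n (φ m)) := by
  have h := (quotientCLM S).continuous.comp (continuous_composeFirst_sub φ R L hcont n)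
  constructor
  · intro h'
    exact (h'.sub h).congr fun m => by simp
  · intro h'
    exact (h'.add h).congr fun m => by simp

end Stabilization

/-- Lemma 6.4 (Jewell--Sinclair stabilization): if `φ R n - L n φ` is continuous for
all `n ≥ 1`, then the closures `cl(L 1 ⋯ L n 𝔖(φ))` stabilize. -/
theorem jewell_sinclair_stabilization
    {K M N : Type*} [NontriviallyNormedField K] [CompleteSpace K] [IsUltrametricDist K]
    [NormedAddCommGroup M] [NormedSpace K M] [CompleteSpace M]
    [NormedAddCommGroup N] [NormedSpace K N] [CompleteSpace N]
    (φ : M →ₗ[K] N) (R : ℕ → M →L[K] M) (L : ℕ → N →L[K] N)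
    (hcont : ∀ n : ℕ, 1 ≤ n → Continuous fun m => φ (R n m) - L n (φ m)) :
    ∃ k : ℕ, 0 < k ∧ ∀ n : ℕ, k ≤ n →
      closure (composeFirst L n '' separatingSpace (fun m => φ m)) =
        closure (composeFirst L k '' separatingSpace (fun m => φ m)) := by
  have hanti := antitone_closure_image_composeFirst φ R L hcont
  have key : ∀ᶠ n in atTop,
      Continuous fun m => quotientCLM (stableSubmodule φ L (n + 1)) (φ (composeFirst R n m)) := by
    refine eventually_continuous_comp_composeFirst R
      (F := fun n => N ⧸ stableSubmodule φ L n)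
      (fun n => (quotientCLM (stableSubmodule φ L n) : N →ₗ[K] N ⧸ stableSubmodule φ L n) ∘ₗ φ) (fun x => ?_) fun n => ?_
    · exact ⟨‖φ x‖, fun n => Submodule.Quotient.norm_mk_le _ _⟩
    · refine (continuous_quotientCLM_comp_iff φ R L hcont _ n).2 ?_
      refine continuous_comp_of_forall_separatingSpace φ
        ((quotientCLM (stableSubmodule φ L n)).comp (composeFirst L n)) fun y hy => ?_
      exact (quotientCLM_eq_zero_iff _ _).2 (subset_closure ⟨y, hy, rfl⟩)
  obtain ⟨k, hk⟩ := eventually_atTop.1 key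
  have hstep (n : ℕ) (hn : k ≤ n) :
      closure (composeFirst L n '' separatingSpace (fun m => φ m)) ⊆
        closure (composeFirst L (n + 1) '' separatingSpace (fun m => φ m)) := by
    refine closure_minimal ?_ isClosed_closure
    rintro _ ⟨y, hy, rfl⟩
    have h := (continuous_quotientCLM_comp_iff φ R L hcont _ n).1 (hk n hn)
    exact (quotientCLM_eq_zero_iff _ _).1 (eq_zero_of_mem_separatingSpace φ
      ((quotientCLM (stableSubmodule φ L (n + 1))).comp (composeFirst L n)) h hy)
  refine ⟨k + 1, k.succ_pos, fun n hn => (hanti hn).antisymm ?_⟩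
  induction n, hn using Nat.le_induction with
  | base => exact subset_rfl
  | succ n hn ih => exact ih.trans (hstep n (by omega))
end

section
/- Let K be a nonarchimedean field of characteristic zero and let L be a Banach K-algebra which is a field (its Banach algebra norm need not be multiplicative). If the field extension K ⊂ L is algebraic, then L is a finite extension of K, and the Banach K-algebra norm on L is equivalent to a multiplicative nonarchimedean norm (so L itself is a nonarchimedean field). -/
theorem natDegree_minpoly_lt_of_not_linearIndependent_pow {F E : Type*} [Field F] [Field E]
    [Algebra F E] {x : E} {n : ℕ} (h : ¬LinearIndependent F fun i : Fin n => x ^ (i : ℕ)) :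
    (minpoly F x).natDegree < n := by
  contrapose! h
  exact (linearIndependent_pow x).comp (Fin.castLE h) (Fin.castLE_injective h)

theorem not_linearIndependent_pow_natDegree_minpoly {F E : Type*} [Field F] [Ring E]
    [Algebra F E] {x : E} (hx : IsIntegral F x) :
    ¬LinearIndependent F fun i : Fin ((minpoly F x).natDegree + 1) => x ^ (i : ℕ) := by
  intro h
  have hsum := minpoly.aeval F x
  rw [Polynomial.aeval_eq_sum_range, Finset.sum_range] at hsum
  have hlead := Fintype.linearIndependent_iff.mp h _ hsum (Fin.last _)
  simp [(minpoly.monic hx).leadingCoeff] at hlead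

open IntermediateField in
theorem finiteDimensional_of_natDegree_minpoly_le {F E : Type*} [Field F] [Field E] [Algebra F E]
    [Algebra.IsAlgebraic F E] [Algebra.IsSeparable F E] (n : ℕ)
    (h : ∀ x : E, (minpoly F x).natDegree ≤ n) : FiniteDimensional F E := by
  have hbdd : BddAbove (Set.range fun x : E => (minpoly F x).natDegree) :=
    ⟨n, by rintro _ ⟨x, rfl⟩; exact h x⟩
  obtain ⟨x, hx⟩ := Nat.sSup_mem (Set.range_nonempty _) hbdd
  have hmax (y : E) : (minpoly F y).natDegree ≤ (minpoly F x).natDegree := by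
    simp only at hx
    rw [hx]
    exact le_csSup hbdd ⟨y, rfl⟩
  have hint (y : E) : IsIntegral F y := Algebra.IsIntegral.isIntegral y
  refine Field.FiniteDimensional.of_exists_primitive_element F E ⟨x, eq_top_iff.mpr fun y _ => ?_⟩
  have : FiniteDimensional F F⟮x⟯ := adjoin.finiteDimensional (hint x)
  have : FiniteDimensional F F⟮y⟯ := adjoin.finiteDimensional (hint y)
  let M : IntermediateField F E := F⟮x⟯ ⊔ F⟮y⟯
  obtain ⟨z, hz⟩ := Field.exists_primitive_element F M
  have hM : Module.finrank F M ≤ Module.finrank F F⟮x⟯ := by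
    rw [← finrank_top', ← hz, adjoin.finrank (Algebra.IsIntegral.isIntegral z),
      adjoin.finrank (hint x), ← minpoly.algebraMap_eq (algebraMap M E).injective]
    exact hmax _
  have heq : F⟮x⟯ = M := eq_of_le_of_finrank_le le_sup_left hM
  rw [heq]
  exact (le_sup_right : F⟮y⟯ ≤ M) (mem_adjoin_simple_self F y)

open IntermediateField in
theorem natDegree_minpoly_sub_le {F E : Type*} [Field F] [Field E] [Algebra F E] {x y : E}
    (hx : IsIntegral F x) (hy : IsIntegral F y) :
    (minpoly F (x - y)).natDegree ≤ (minpoly F x).natDegree * (minpoly F y).natDegree := by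
  have : FiniteDimensional F F⟮x⟯ := adjoin.finiteDimensional hx
  have : FiniteDimensional F F⟮y⟯ := adjoin.finiteDimensional hy
  let M : IntermediateField F E := F⟮x⟯ ⊔ F⟮y⟯
  have hxM : x ∈ M := (le_sup_left : F⟮x⟯ ≤ M) (mem_adjoin_simple_self F x)
  have hyM : y ∈ M := (le_sup_right : F⟮y⟯ ≤ M) (mem_adjoin_simple_self F y)
  rw [← adjoin.finrank hx, ← adjoin.finrank hy]
  refine le_trans ?_ (finrank_sup_le F⟮x⟯ F⟮y⟯)
  have := minpoly.algebraMap_eq (A := F) (algebraMap M E).injective (⟨x, hxM⟩ - ⟨y, hyM⟩)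
  exact (congrArg Polynomial.natDegree this).trans_le (minpoly.natDegree_le _)

open IntermediateField in
theorem natDegree_minpoly_smul {F E : Type*} [Field F] [Field E] [Algebra F E] {x : E}
    (hx : IsIntegral F x) {a : F} (ha : a ≠ 0) :
    (minpoly F (a • x)).natDegree = (minpoly F x).natDegree := by
  have hadj : F⟮a • x⟯ = F⟮x⟯ := by
    refine le_antisymm (adjoin_simple_le_iff.mpr (smul_mem _ (mem_adjoin_simple_self F x)))
      (adjoin_simple_le_iff.mpr ?_)
    simpa [ha] using smul_mem F⟮a • x⟯ (mem_adjoin_simple_self F (a • x)) (x := a⁻¹)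
  rw [← adjoin.finrank (hx.smul a), ← adjoin.finrank hx, hadj]

theorem exists_natDegree_minpoly_le {K L : Type*} [NontriviallyNormedField K] [CompleteSpace K]
    [NormedCommRing L] [NormedAlgebra K L] [CompleteSpace L]
    (hfield : IsField L) [Algebra.IsAlgebraic K L] :
    ∃ n : ℕ, ∀ x : L, (minpoly K x).natDegree ≤ n := by
  let : Field L := hfield.toField
  have hint (x : L) : IsIntegral K x := Algebra.IsIntegral.isIntegral x
  let A (n : ℕ) : Set L := {x | ¬LinearIndependent K fun i : Fin (n + 1) => x ^ (i : ℕ)}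
  have hclosed (n : ℕ) : IsClosed (A n) := by
    have hcont : Continuous fun (x : L) (i : Fin (n + 1)) => x ^ (i : ℕ) := by fun_prop
    exact (isOpen_setOfPred_linearIndependent.preimage hcont).isClosed_compl
  have hcover : ⋃ n, A n = Set.univ := Set.eq_univ_of_forall fun x =>
    Set.mem_iUnion.mpr ⟨_, not_linearIndependent_pow_natDegree_minpoly (hint x)⟩
  obtain ⟨n, x, hx⟩ := nonempty_interior_of_iUnion_of_closed hclosed hcover
  have hdeg {y : L} (hy : y ∈ A n) : (minpoly K y).natDegree ≤ n :=
    Nat.lt_succ_iff.mp (natDegree_minpoly_lt_of_not_linearIndependent_pow hy)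
  refine ⟨n * n, fun y => ?_⟩
  have hlim : Filter.Tendsto (fun t : K => x + t • y) (nhdsWithin 0 {0}ᶜ) (nhds x) := by
    have hcont : Continuous fun t : K => x + t • y := by fun_prop
    simpa using (hcont.tendsto 0).mono_left nhdsWithin_le_nhds
  obtain ⟨t, ht, ht0⟩ := ((hlim.eventually (isOpen_interior.mem_nhds hx)).and
    self_mem_nhdsWithin).exists
  have := natDegree_minpoly_sub_le (hint (x + t • y)) (hint x)
  rw [add_sub_cancel_left, natDegree_minpoly_smul (hint y) ht0] at this
  exact this.trans (Nat.mul_le_mul (hdeg (interior_subset ht)) (hdeg (interior_subset hx)))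

theorem exists_norm_equiv_spectralNorm {K E L : Type*} [NontriviallyNormedField K]
    [CompleteSpace K] [IsUltrametricDist K] [NormedAddCommGroup E] [NormedSpace K E]
    [Field L] [Algebra K L] [FiniteDimensional K L] (e : E ≃ₗ[K] L) :
    ∃ c C : ℝ, 0 < c ∧ 0 < C ∧
      ∀ x, c * ‖x‖ ≤ spectralNorm K L (e x) ∧ spectralNorm K L (e x) ≤ C * ‖x‖ := by
  have : FiniteDimensional K E := e.symm.finiteDimensional
  let := spectralNorm.normedAddCommGroup K L
  let := spectralNorm.normedSpace K L
  obtain ⟨C, hC, hle⟩ := (LinearMap.toContinuousLinearMap (e : E →ₗ[K] L)).bound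
  obtain ⟨D, hD, hge⟩ := (LinearMap.toContinuousLinearMap (e.symm : L →ₗ[K] E)).bound
  refine ⟨D⁻¹, C, inv_pos.mpr hD, hC, fun x => ⟨?_, hle x⟩⟩
  rw [inv_mul_le_iff₀ hD]
  exact (congrArg norm (e.symm_apply_apply x)).symm.trans_le (hge (e x))

/-- Lemma 7.2: if `L` is a Banach algebra over a nonarchimedean field `K` of
characteristic zero, `L` is a field, and the extension `K ⊆ L` is algebraic, then
`L` is finite over `K` and the norm of `L` is equivalent to a multiplicative
nonarchimedean norm. -/
theorem finite_and_nonarchimedean_of_algebraic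
    {K L : Type*} [NontriviallyNormedField K] [CompleteSpace K] [IsUltrametricDist K]
    [CharZero K]
    [NormedCommRing L] [NormedAlgebra K L] [CompleteSpace L]
    (hfield : IsField L) (halg : Algebra.IsAlgebraic K L) :
    Module.Finite K L ∧
      ∃ f : L → ℝ, (∀ x, 0 ≤ f x) ∧ (∀ x, f x = 0 ↔ x = 0) ∧
        (∀ x y, f (x * y) = f x * f y) ∧
        (∀ x y, f (x + y) ≤ max (f x) (f y)) ∧
        ∃ c C : ℝ, 0 < c ∧ 0 < C ∧ ∀ x, c * ‖x‖ ≤ f x ∧ f x ≤ C * ‖x‖ := by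
  obtain ⟨n, hn⟩ := exists_natDegree_minpoly_le (K := K) hfield
  let : Field L := hfield.toField
  have hfin : FiniteDimensional K L := finiteDimensional_of_natDegree_minpoly_le n hn
  refine ⟨hfin, spectralNorm K L, spectralNorm_nonneg,
    fun x => map_eq_zero_iff_eq_zero (spectralMulAlgNorm K L), spectralAlgNorm_mul,
    isNonarchimedean_spectralNorm, exists_norm_equiv_spectralNorm (LinearEquiv.refl K L)⟩
end

section
/- Let K be a nonarchimedean field of characteristic zero and let L be a Banach K-algebra which is a field. Then the following are equivalent: (1) every K-linear derivation of L is continuous; (2) every K-linear derivation of L is zero; (3) the field extension K ⊂ L is algebraic; (4) the field extension K ⊂ L is finite. Moreover, if one (hence all) of these conditions holds, then the Banach K-algebra norm on L is equivalent to a multiplicative nonarchimedean norm. -/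
open Filter Topology Bornology

/-- Linear independence of the values of a finite family of polynomials is a generic condition:
if it holds at `0`, then it holds away from the zeros of a nonzero polynomial. -/
theorem exists_polynomial_linearIndependent_eval {ι K L : Type*} [Finite ι] [Field K] [CommRing L]
    [Algebra K L] (p : ι → Polynomial L) (h : LinearIndependent K fun i ↦ (p i).eval 0) :
    ∃ P : Polynomial K, P ≠ 0 ∧ ∀ s : K, P.eval s ≠ 0 →
      LinearIndependent K fun i ↦ (p i).eval (algebraMap K L s) := by
  classical
  cases nonempty_fintype ι
  obtain ⟨f, hf⟩ := LinearMap.exists_leftInverse_of_injective _ (LinearMap.ker_eq_bot.2 h)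
  let M : Matrix ι ι (Polynomial K) := .of fun k i ↦
    ∑ n ∈ Finset.range ((p i).natDegree + 1), Polynomial.C (f ((p i).coeff n) k) * Polynomial.X ^ n
  have hM (s : K) (k i : ι) : (M k i).eval s = f ((p i).eval (algebraMap K L s)) k := by
    rw [Polynomial.eval_eq_sum_range (p := p i), map_sum, Finsupp.finsetSum_apply,
      show M k i = ∑ n ∈ Finset.range ((p i).natDegree + 1),
        Polynomial.C (f ((p i).coeff n) k) * Polynomial.X ^ n from rfl, Polynomial.eval_finsetSum]
    refine Finset.sum_congr rfl fun n _ ↦ ?_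
    rw [mul_comm ((p i).coeff n), ← map_pow, ← Algebra.smul_def, map_smul, Finsupp.smul_apply,
      Polynomial.eval_mul, Polynomial.eval_C, Polynomial.eval_pow, Polynomial.eval_X, smul_eq_mul,
      mul_comm]
  have hdet (s : K) : M.det.eval s =
      (Matrix.of fun k i ↦ f ((p i).eval (algebraMap K L s)) k).det := by
    rw [← Polynomial.coe_evalRingHom, RingHom.map_det]
    congr 1
    ext k i
    simp [hM]
  refine ⟨M.det, fun h0 ↦ ?_, fun s hs ↦ ?_⟩
  · have h1 := hdet 0
    have h2 : (Matrix.of fun k i ↦ f ((p i).eval (algebraMap K L 0)) k) = 1 := by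
      ext k i
      have := DFunLike.congr_fun (LinearMap.congr_fun hf (Finsupp.single i 1)) k
      simp only [LinearMap.comp_apply, Finsupp.linearCombination_single, one_smul] at this
      simp [this, Matrix.one_apply, Finsupp.single_apply, eq_comm]
    rw [h0, h2] at h1
    simp at h1
  · rw [Fintype.linearIndependent_iff]
    intro g hg
    rw [hdet] at hs
    refine congr_fun (Matrix.eq_zero_of_mulVec_eq_zero hs (v := g) ?_)
    ext k
    have := DFunLike.congr_fun (congr_arg f hg) k
    simpa [Matrix.mulVec, dotProduct, Finsupp.finsetSum_apply, mul_comm] using this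

/-- If every element of a Banach algebra satisfies one of countably many linear dependence
conditions between monomials, then all elements satisfy one and the same condition. -/
theorem exists_forall_not_linearIndependent_mul_pow {K L : Type*} [NontriviallyNormedField K]
    [CompleteSpace K] [NormedCommRing L] [NormedAlgebra K L] [CompleteSpace L]
    {ι : ℕ → Type*} [∀ d, Finite (ι d)] (c : ∀ d, ι d → L) (j : ∀ d, ι d → ℕ)
    (h : ∀ x : L, ∃ d, ¬ LinearIndependent K fun i ↦ c d i * x ^ j d i) :
    ∃ d, ∀ y : L, ¬ LinearIndependent K fun i ↦ c d i * y ^ j d i := by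
  obtain ⟨d, a, ha⟩ := nonempty_interior_of_iUnion_of_closed
    (f := fun d ↦ {x : L | ¬ LinearIndependent K fun i ↦ c d i * x ^ j d i})
    (fun d ↦ ⟨by
      have hc : Continuous fun (x : L) (i : ι d) ↦ c d i * x ^ j d i := by fun_prop
      simpa [Set.compl_def] using!
        (isOpen_setOfPred_linearIndependent (𝕜 := K) (ι := ι d) (E := L)).preimage hc⟩)
    (Set.eq_univ_of_forall fun x ↦ Set.mem_iUnion.2 (h x))
  refine ⟨d, fun y hy ↦ ?_⟩
  obtain ⟨P, hP, hPs⟩ := exists_polynomial_linearIndependent_eval (K := K)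
    (fun i ↦ Polynomial.C (c d i) * (Polynomial.C y + Polynomial.X * Polynomial.C a) ^ j d i)
    (by simpa using hy)
  have hlim : Tendsto (fun s : K ↦ a + s⁻¹ • y) (cobounded K) (𝓝 a) := by
    have : Tendsto (fun s : K ↦ s⁻¹) (cobounded K) (𝓝 0) := tendsto_inv₀_cobounded
    simpa using tendsto_const_nhds.add (this.smul_const y)
  have hroots : ∀ᶠ s in cobounded K, P.eval s ≠ 0 := by
    refine le_cofinite K ?_
    simpa [Filter.mem_cofinite, Set.compl_def] using! Polynomial.finite_setOfPred_isRoot hP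
  have hne : ∀ᶠ s in cobounded K, s ≠ 0 := le_cofinite K (by simp [Filter.mem_cofinite, Set.compl_def])
  obtain ⟨s, ⟨hs, hs'⟩, hs0⟩ :=
    ((hlim.eventually (mem_interior_iff_mem_nhds.1 ha)).and hroots |>.and hne).exists
  refine hs ?_
  have := (hPs s hs').units_smul (fun i ↦ (Units.mk0 s hs0)⁻¹ ^ j d i)
  convert! this using 2 with i
  have e : a + s⁻¹ • y = s⁻¹ • (y + algebraMap K L s * a) := by
    rw [smul_add, ← Algebra.smul_def, smul_smul, inv_mul_cancel₀ hs0, one_smul, add_comm]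
  simp [e, smul_pow, Units.smul_def, -smul_add, mul_comm a]

/-- The monomials in an algebraically independent family are linearly independent. -/
theorem AlgebraicIndependent.linearIndependent_prod_pow {σ K L : Type*} [Fintype σ] [CommRing K]
    [CommRing L] [Algebra K L] {b : σ → L} (hb : AlgebraicIndependent K b) :
    LinearIndependent K fun m : σ → ℕ ↦ ∏ i, b i ^ m i := by
  have h := ((MvPolynomial.basisMonomials σ K).linearIndependent.map'
    (MvPolynomial.aeval b).toLinearMap (LinearMap.ker_eq_bot.2 hb)).comp
    _ Finsupp.equivFunOnFinite.symm.injective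
  convert! h using 2 with m
  simp [MvPolynomial.aeval_monomial, Finsupp.prod_fintype]

/-- A finite family is algebraically independent if the monomials with bounded exponents are
linearly independent, for all bounds. -/
theorem AlgebraicIndependent.of_linearIndependent_prod_pow {σ K L : Type*} [Fintype σ]
    [CommRing K] [CommRing L] [Algebra K L] {b : σ → L}
    (h : ∀ d, LinearIndependent K fun m : σ → Fin d ↦ ∏ i, b i ^ (m i : ℕ)) :
    AlgebraicIndependent K b := by
  classical
  rw [algebraicIndependent_iff]
  intro p hp
  rw [MvPolynomial.aeval_def, MvPolynomial.eval₂_eq'] at hp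
  have hd (m : p.support) (i : σ) : (m : σ →₀ ℕ) i < p.totalDegree + 1 :=
    Nat.lt_succ_of_le <| (Finsupp.le_degree i _).trans (MvPolynomial.le_totalDegree m.2)
  have hli : LinearIndependent K fun m : p.support ↦ ∏ i, b i ^ (m : σ →₀ ℕ) i :=
    (h (p.totalDegree + 1)).comp (fun (m : p.support) i ↦ ⟨(m : σ →₀ ℕ) i, hd m i⟩) fun m m' hm ↦ by
      refine Subtype.ext (Finsupp.ext fun i ↦ ?_)
      simpa using congr_fun hm i
  rw [Fintype.linearIndependent_iff] at hli
  have h0 := hli (fun m ↦ p.coeff m) (by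
    rw [← Finset.sum_coe_sort] at hp
    simpa [Algebra.smul_def] using hp)
  ext m
  by_cases hm : m ∈ p.support
  · simpa using h0 ⟨m, hm⟩
  · simpa using hm

/-- A Banach algebra has no nonempty finite transcendence basis. -/
theorem not_isTranscendenceBasis_of_finite {σ K L : Type*} [NontriviallyNormedField K]
    [CompleteSpace K] [NormedCommRing L] [NormedAlgebra K L] [CompleteSpace L] [Finite σ]
    [Nonempty σ] (b : σ → L) : ¬ IsTranscendenceBasis K b := by
  classical
  intro hb
  cases nonempty_fintype σ
  obtain ⟨d, hd⟩ := exists_forall_not_linearIndependent_mul_pow (K := K)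
    (ι := fun d ↦ Option σ → Fin d) (fun d m ↦ ∏ i, b i ^ (m (some i) : ℕ))
    (fun d m ↦ m none) fun x ↦ by
      by_contra! hx
      have : AlgebraicIndependent K fun o : Option σ ↦ o.elim x b :=
        .of_linearIndependent_prod_pow fun d ↦ by
          simpa [Fintype.prod_option, mul_comm] using hx d
      exact (hb.1.option_iff_transcendental x).1 this (hb.isAlgebraic.isAlgebraic x)
  obtain ⟨i₀⟩ := ‹Nonempty σ›
  refine hd (b i₀ ^ d) ?_
  convert! hb.1.linearIndependent_prod_pow.comp (fun (m : Option σ → Fin d) i ↦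
    (m (some i) : ℕ) + if i = i₀ then d * m none else 0) fun m m' hm ↦ ?_ using 2 with m
  · simp only [Function.comp_apply, pow_add, Finset.prod_mul_distrib, pow_ite, pow_zero, Finset.prod_ite_eq',
      Finset.mem_univ, if_true, pow_mul]
  · have h₀ := congr_fun hm i₀
    simp only [if_true] at h₀
    have hlt := (m (some i₀)).2
    have hlt' := (m' (some i₀)).2
    have hnone : (m none : ℕ) = m' none := by
      have := congr_arg (· / d) h₀
      simpa [Nat.add_mul_div_left _ _ (pos_of_gt hlt), Nat.div_eq_of_lt hlt,
        Nat.div_eq_of_lt hlt'] using this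
    ext (_ | i)
    · exact hnone
    · have := congr_fun hm i
      simp only [hnone] at this
      omega

/-- In characteristic zero, a derivation may be prescribed arbitrarily on a transcendence basis. -/
theorem IsTranscendenceBasis.exists_derivation {σ K L : Type*} [Field K] [CharZero K] [Field L]
    [Algebra K L] {b : σ → L} (hb : IsTranscendenceBasis K b) (c : σ → L) :
    ∃ δ : Derivation K L L, ∀ i, δ (b i) = c i := by
  let A := MvPolynomial σ K
  let : Algebra A L := (MvPolynomial.aeval b).toAlgebra
  have : IsScalarTower K A L := .of_algebraMap_eq' (MvPolynomial.aeval b).comp_algebraMap.symm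
  have hinj : Function.Injective (algebraMap A L) := hb.1
  have : FaithfulSMul A L := (faithfulSMul_iff_algebraMap_injective A L).2 hinj
  have : CharZero A := charZero_of_injective_algebraMap (algebraMap K A).injective
  let F := FractionRing A
  let : Algebra F L := FractionRing.liftAlgebra A L
  have : Algebra.IsAlgebraic A L := by
    have := hb.isAlgebraic
    exact .of_ringHom_of_comp_eq hb.1.aevalEquiv.toRingEquiv (RingHom.id L)
      hb.1.aevalEquiv.surjective Function.injective_id rfl
  have : Algebra.IsAlgebraic F L := (IsFractionRing.comap_isAlgebraic_iff (A := A)).1 inferInstance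
  have : CharZero F := charZero_of_injective_algebraMap (IsFractionRing.injective A F)
  have : Algebra.FormallyEtale F L := .of_isSeparable F L
  have : Algebra.FormallyEtale A F := .of_isLocalization (nonZeroDivisors A)
  have : Algebra.FormallyEtale A L := .comp A F L
  let B := ((KaehlerDifferential.mvPolynomialBasis K σ).baseChange L).map
    (KaehlerDifferential.tensorKaehlerEquivOfFormallyEtale K A L)
  refine ⟨(B.constr L c).compDer (KaehlerDifferential.D K L), fun i ↦ ?_⟩
  have hB : KaehlerDifferential.D K L (b i) = B i := by
    have hX : algebraMap A L (MvPolynomial.X i) = b i := MvPolynomial.aeval_X b i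
    rw [← hX, ← KaehlerDifferential.map_D K K A L]
    simp [B, A]
  simp [hB]

/-- An algebraic extension in characteristic zero is finite if its elements have bounded degree. -/
theorem finite_of_natDegree_minpoly_le {K L : Type*} [Field K] [CharZero K] [Field L]
    [Algebra K L] [Algebra.IsAlgebraic K L] (d : ℕ) (h : ∀ x : L, (minpoly K x).natDegree ≤ d) :
    Module.Finite K L := by
  have hr : Module.rank K L ≤ d := rank_le fun s hs ↦ by
    let E := IntermediateField.adjoin K (s : Set L)
    have : FiniteDimensional K E := IntermediateField.finiteDimensional_adjoin
      fun x _ ↦ Algebra.IsIntegral.isIntegral x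
    obtain ⟨z, hz⟩ := Field.exists_primitive_element K E
    have h1 : Module.finrank K E ≤ d := by
      rw [← IntermediateField.finrank_top', ← hz, IntermediateField.adjoin.finrank
        (Algebra.IsIntegral.isIntegral z), ← minpoly.algebraMap_eq (algebraMap E L).injective]
      exact h _
    let v : s → E := fun x ↦ ⟨x, IntermediateField.subset_adjoin K _ x.2⟩
    have hv : LinearIndependent K v := .of_comp E.val.toLinearMap hs
    simpa using hv.fintype_card_le_finrank.trans h1
  exact Module.rank_lt_aleph0_iff.1 (hr.trans_lt (Cardinal.natCast_lt_aleph0))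

/-- Algebraic extensions in characteristic zero have no nonzero derivations. -/
theorem derivation_eq_zero_of_isAlgebraic {K L : Type*} [Field K] [CharZero K] [Field L]
    [Algebra K L] [Algebra.IsAlgebraic K L] (δ : Derivation K L L) : δ = 0 := by
  have := Algebra.FormallyUnramified.of_isSeparable K L
  exact (KaehlerDifferential.linearMapEquivDerivation K L).symm.injective (Subsingleton.elim _ _)

/-- Linear equivalences of finite-dimensional normed spaces are bounded above and below. -/
theorem LinearEquiv.exists_norm_bounds {K E F : Type*} [NontriviallyNormedField K]
    [CompleteSpace K] [NormedAddCommGroup E] [NormedSpace K E] [NormedAddCommGroup F]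
    [NormedSpace K F] [FiniteDimensional K E] (e : E ≃ₗ[K] F) :
    ∃ c C : ℝ, 0 < c ∧ 0 < C ∧ ∀ x, c * ‖x‖ ≤ ‖e x‖ ∧ ‖e x‖ ≤ C * ‖x‖ := by
  have : FiniteDimensional K F := e.finiteDimensional
  obtain ⟨C, hC, hC'⟩ := e.toLinearMap.toContinuousLinearMap.bound
  obtain ⟨D, hD, hD'⟩ := e.symm.toLinearMap.toContinuousLinearMap.bound
  refine ⟨D⁻¹, C, inv_pos.2 hD, hC, fun x ↦ ⟨?_, hC' x⟩⟩
  rw [inv_mul_le_iff₀ hD]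
  simpa using hD' (e x)

/-- A finite field extension of a complete nonarchimedean field, normed as an algebra, has an
equivalent multiplicative nonarchimedean norm, the spectral norm. -/
theorem exists_equivalent_mul_norm {K L : Type*} [NontriviallyNormedField K] [CompleteSpace K]
    [IsUltrametricDist K] [NormedCommRing L] [NormedAlgebra K L] (hfield : IsField L)
    [Module.Finite K L] :
    ∃ f : L → ℝ, (∀ x, 0 ≤ f x) ∧ (∀ x, f x = 0 ↔ x = 0) ∧
      (∀ x y, f (x * y) = f x * f y) ∧
      (∀ x y, f (x + y) ≤ max (f x) (f y)) ∧
      ∃ c C : ℝ, 0 < c ∧ 0 < C ∧ ∀ x, c * ‖x‖ ≤ f x ∧ f x ≤ C * ‖x‖ := by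
  let iF : Field L := hfield.toField
  refine ⟨spectralNorm K L, spectralNorm_nonneg, fun x ↦
    ⟨fun h ↦ eq_zero_of_map_spectralNorm_eq_zero h (Algebra.IsAlgebraic.isAlgebraic x), ?_⟩, ?_,
    isNonarchimedean_spectralNorm, ?_⟩
  · rintro rfl; exact spectralNorm_zero
  · exact map_mul (spectralMulAlgNorm K L)
  · exact @LinearEquiv.exists_norm_bounds K L L _ _ _ _ (spectralNorm.normedAddCommGroup K L)
      (spectralNorm.normedSpace K L) _ (LinearEquiv.refl K L)

/-- A Banach algebra which is an algebraic field extension in characteristic zero is finite. -/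
theorem finite_of_isAlgebraic_of_isField {K L : Type*} [NontriviallyNormedField K]
    [CompleteSpace K] [CharZero K] [NormedCommRing L] [NormedAlgebra K L] [CompleteSpace L]
    (hfield : IsField L) [Algebra.IsAlgebraic K L] : Module.Finite K L := by
  have : Nontrivial L := hfield.nontrivial
  obtain ⟨d, hd⟩ := exists_forall_not_linearIndependent_mul_pow (K := K) (L := L)
    (ι := Fin) (fun d _ ↦ 1) (fun d i ↦ i) fun x ↦ by
      refine ⟨(minpoly K x).natDegree + 1, fun hx ↦ ?_⟩
      rw [Fintype.linearIndependent_iff] at hx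
      have := hx (fun i ↦ (minpoly K x).coeff i) (by
        rw [Fin.sum_univ_eq_sum_range
          (fun i ↦ (minpoly K x).coeff i • ((1 : L) * x ^ i)) ((minpoly K x).natDegree + 1)]
        simpa [Polynomial.aeval_eq_sum_range] using minpoly.aeval K x) (Fin.last _)
      simp [minpoly.ne_zero (Algebra.IsIntegral.isIntegral (R := K) x)] at this
  refine @finite_of_natDegree_minpoly_le K L _ _ hfield.toField _ _ d fun x ↦ ?_
  by_contra! hx
  refine hd x ?_
  simpa using! (linearIndependent_pow (K := K) x).comp (Fin.castLE hx.le)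
    (Fin.castLE_injective hx.le)

/-- A Banach algebra which is a field of characteristic zero is algebraic over the base field if
all its derivations are continuous. -/
theorem isAlgebraic_of_continuous_derivation {K L : Type*} [NontriviallyNormedField K]
    [CompleteSpace K] [CharZero K] [NormedCommRing L] [NormedAlgebra K L] [CompleteSpace L]
    (hfield : IsField L) (h : ∀ δ : Derivation K L L, Continuous δ) :
    Algebra.IsAlgebraic K L := by
  have : IsDomain L := hfield.isDomain
  obtain ⟨s, hs⟩ := exists_isTranscendenceBasis K L
  cases isEmpty_or_nonempty s
  · exact (IsTranscendenceBasis.isEmpty_iff_isAlgebraic hs).1 ‹_›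
  cases finite_or_infinite s
  · exact (not_isTranscendenceBasis_of_finite _ hs).elim
  let u : ℕ ↪ s := Infinite.natEmbedding s
  choose k hk using fun n : ℕ ↦ NormedField.exists_lt_norm K n
  obtain ⟨δ, hδ⟩ := @IsTranscendenceBasis.exists_derivation s K L _ _ hfield.toField _ _ hs
    fun i ↦ k (Function.invFun u i) • (i : L)
  obtain ⟨C, -, hC⟩ := (⟨δ.toLinearMap, h δ⟩ : L →L[K] L).bound
  obtain ⟨n, hn⟩ := exists_nat_gt C
  have hpos : 0 < ‖((u n : s) : L)‖ := norm_pos_iff.2 (hs.1.ne_zero (u n))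
  have h1 : δ (u n : s) = k n • ((u n : s) : L) := by
    rw [hδ, Function.leftInverse_invFun u.injective]
  have h2 : ‖δ (u n : s)‖ ≤ C * ‖((u n : s) : L)‖ := hC _
  rw [h1, norm_smul] at h2
  linarith [le_of_mul_le_mul_right h2 hpos, hk n]

/-- Proposition 7.1: for a Banach algebra `L` over a nonarchimedean field `K` of
characteristic zero such that `L` is a field, the following are equivalent:
every `K`-linear derivation of `L` is continuous; every `K`-linear derivation of `L`
is zero; `L` is algebraic over `K`; `L` is finite over `K`.  Moreover, if these
conditions hold, the norm of `L` is equivalent to a multiplicative nonarchimedean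
norm. -/
theorem derivations_continuous_tfae
    {K L : Type*} [NontriviallyNormedField K] [CompleteSpace K] [IsUltrametricDist K]
    [CharZero K]
    [NormedCommRing L] [NormedAlgebra K L] [CompleteSpace L]
    (hfield : IsField L) :
    [(∀ δ : Derivation K L L, Continuous δ),
      (∀ δ : Derivation K L L, δ = 0),
      Algebra.IsAlgebraic K L,
      Module.Finite K L].TFAE ∧
    (Module.Finite K L →
      ∃ f : L → ℝ, (∀ x, 0 ≤ f x) ∧ (∀ x, f x = 0 ↔ x = 0) ∧
        (∀ x y, f (x * y) = f x * f y) ∧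
        (∀ x y, f (x + y) ≤ max (f x) (f y)) ∧
        ∃ c C : ℝ, 0 < c ∧ 0 < C ∧ ∀ x, c * ‖x‖ ≤ f x ∧ f x ≤ C * ‖x‖) := by
  refine ⟨?_, fun _ ↦ exists_equivalent_mul_norm (K := K) hfield⟩
  tfae_have 1 → 3 := isAlgebraic_of_continuous_derivation hfield
  tfae_have 3 → 4 := fun _ ↦ finite_of_isAlgebraic_of_isField hfield
  tfae_have 4 → 3 := fun _ ↦ Algebra.IsAlgebraic.of_finite K L
  tfae_have 3 → 2 := fun _ δ ↦ @derivation_eq_zero_of_isAlgebraic K L _ _ hfield.toField _ _ δ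
  tfae_have 2 → 1 := fun h δ ↦ by
    rw [h δ]
    exact continuous_zero
  tfae_finish
end
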